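/- Let v be a node of a tree P with children v_1,…,v_k ordered from left to right, where k ≥ 2, and let T be a tree. For any node w ∈ emb(P(v),T) there exists a pair of nodes (w_1,w_k) ∈ mop(emb(P(v_1),T),…,emb(P(v_k),T)) such that w = fl(nca(w_1,w_k), label(v)). -/

import Mathlib

namespace TreeIncl

/-- Rooted, ordered, labeled trees: a label and an ordered list of children. -/
inductive OTree (α : Type) : Type where
  | node : α → List (OTree α) → OTree α

namespace OTree

variable {α β : Type}

/-- The label of the root. -/
def label : OTree α → α
  | node a _ => a

/-- The (ordered) children subtrees of the root. -/
def children : OTree α → List (OTree α)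
  | node _ cs => cs

/-- Nodes are identified with positions: lists of child indices from the root. -/
abbrev Node : Type := List ℕ

/-- The subtree rooted at a given position, if the position is valid. -/
def sub : Node → OTree α → Option (OTree α)
  | [], t => some t
  | i :: p, t =>
    match t.children[i]? with
    | some c => sub p c
    | none => none

/-- The set `V(T)` of (positions of) nodes of a tree. -/
def Pos (t : OTree α) : Set Node := {p | sub p t ≠ none}

/-- The label of the node at position `p`. -/
def labelAt (t : OTree α) (p : Node) : Option α := (sub p t).map label

/-- `l_T`: the number of leaves of a tree. -/
def numLeaves : OTree α → ℕ
  | node _ [] => 1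
  | node a (c :: cs) => numLeaves c + numLeaves (node a cs)

/-- `n_T`: the number of nodes of a tree. -/
def numNodes : OTree α → ℕ
  | node _ [] => 1
  | node a (c :: cs) => numNodes c + numNodes (node a cs)

/-- The number of leaves of the subtree rooted at position `p` (0 if `p` is invalid). -/
def leavesAt (t : OTree α) (p : Node) : ℕ := ((sub p t).map numLeaves).getD 0

/-- `v ⪯ w` : `v` is an ancestor of `w` (positions: prefix). -/
def Anc (v w : Node) : Prop := v <+: w

/-- `v ≺ w` : `v` is a proper ancestor of `w` (positions: strict prefix). -/
def SAnc (v w : Node) : Prop := v <+: w ∧ v ≠ w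

/-- `u ◁ w` : `u` is to the left of `w`
    (equivalently: `pre(u) < pre(w)` and `post(u) < post(w)`). -/
def LeftOf (u w : Node) : Prop :=
  ∃ (q : Node) (i j : ℕ) (u' w' : Node), i < j ∧ u = q ++ i :: u' ∧ w = q ++ j :: w'

/-- `u ⊴ w` : `u ◁ w` or `u ⪯ w` or `w ≺ u`. -/
def LeftOrAbove (u w : Node) : Prop := LeftOf u w ∨ Anc u w ∨ SAnc w u

/-- The nearest common ancestor of two positions: longest common prefix. -/
def nca : Node → Node → Node
  | [], _ => []
  | _, [] => []
  | i :: u, j :: w => if i = j then i :: nca u w else []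

/-- A set of nodes is deep: no node is a proper ancestor of another node in the set. -/
def DeepSet (X : Set Node) : Prop := ∀ x ∈ X, ∀ y ∈ X, ¬ SAnc x y

/-- `Deep(X)`: the elements of `X` having no proper descendant in `X`. -/
def DeepOf (X : Set Node) : Set Node := {x | x ∈ X ∧ ¬ ∃ z ∈ X, SAnc x z}

/-- `Φ(X_1, …, X_k)`: xs is a tuple with `x_i ∈ X_i` and `x_1 ◁ x_2 ◁ ⋯ ◁ x_k`. -/
def Phi (Xs : List (Set Node)) (xs : List Node) : Prop :=
  List.Forall₂ (fun x X => x ∈ X) xs Xs ∧ xs.Chain' LeftOf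

/-- `mop(X_1, …, X_k)`: the set of minimum ordered pairs. -/
def Mop (Xs : List (Set Node)) : Set (Node × Node) :=
  {p | (∃ xs, Phi Xs xs ∧ xs.head? = some p.1 ∧ xs.getLast? = some p.2) ∧
    ¬ ∃ ys y1 yk, Phi Xs ys ∧ ys.head? = some y1 ∧ ys.getLast? = some yk ∧
      ((LeftOf p.1 y1 ∧ LeftOf y1 yk ∧ LeftOrAbove yk p.2) ∨
       (LeftOrAbove p.1 y1 ∧ LeftOf y1 yk ∧ LeftOf yk p.2))}

/-- `MopRight(Y, X)`: for `(y₁,y₂) ∈ Y`, `(y₁,x)` is in the result iff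
    `(y₂,x) ∈ mop(Y|₂, X)`. -/
def MopRight (Y : Set (Node × Node)) (X : Set Node) : Set (Node × Node) :=
  {r | ∃ y2, (r.1, y2) ∈ Y ∧ (y2, r.2) ∈ Mop [Prod.snd '' Y, X]}

/-- `MopLeft(X, Y)`: for `(y₁,y₂) ∈ Y`, `(x,y₂)` is in the result iff
    `(x,y₁) ∈ mop(X, Y|₁)`. -/
def MopLeft (X : Set Node) (Y : Set (Node × Node)) : Set (Node × Node) :=
  {r | ∃ y1, (y1, r.2) ∈ Y ∧ (r.1, y1) ∈ Mop [X, Prod.fst '' Y]}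

/-- One deletion step: delete a node of the tree, making its children children of its
parent (in its place, in order); the root may be deleted when it has exactly one
child. -/
inductive DelStep : OTree α → OTree α → Prop
  | root (a : α) (t : OTree α) : DelStep (node a [t]) t
  | splice (a b : α) (pre cs post : List (OTree α)) :
      DelStep (node a (pre ++ node b cs :: post)) (node a (pre ++ cs ++ post))
  | congr (a : α) (pre post : List (OTree α)) {t t' : OTree α} :
      DelStep t t' → DelStep (node a (pre ++ t :: post)) (node a (pre ++ t' :: post))

/-- `P ⊑ T` : `P` can be obtained from `T` by deleting nodes of `T`. -/
def Included (P T : OTree α) : Prop := Relation.ReflTransGen (fun x y => DelStep x y) T P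

/-- An embedding of `P` in `T`: an injective map of nodes preserving labels,
    proper ancestorship, and the left-of relation. -/
structure IsEmb (P T : OTree α) (f : Node → Node) : Prop where
  mem : ∀ p ∈ Pos P, f p ∈ Pos T
  inj : ∀ p ∈ Pos P, ∀ q ∈ Pos P, f p = f q → p = q
  lab : ∀ p ∈ Pos P, labelAt T (f p) = labelAt P p
  anc : ∀ p ∈ Pos P, ∀ q ∈ Pos P, (SAnc p q ↔ SAnc (f p) (f q))
  ord : ∀ p ∈ Pos P, ∀ q ∈ Pos P, (LeftOf p q ↔ LeftOf (f p) (f q))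

/-- A deep embedding: no other embedding maps the root of `P` strictly deeper. -/
def IsDeepEmb (P T : OTree α) (f : Node → Node) : Prop :=
  IsEmb P T f ∧ ¬ ∃ g, IsEmb P T g ∧ SAnc (f []) (g [])

/-- `emb(P,T)`: the set of deep occurrences of `P` in `T`. -/
def emb (P T : OTree α) : Set Node := {w | ∃ f, IsDeepEmb P T f ∧ f [] = w}

/-- `FlAt T x a q` : `q = fl(x, a)`, the first ancestor of `x` labeled `a` in `T`. -/
def FlAt (t : OTree α) (x : Node) (a : α) (q : Node) : Prop :=
  q <+: x ∧ labelAt t q = some a ∧ ∀ r, SAnc q r → r <+: x → labelAt t r ≠ some a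

/-! ### Heavy leaf path decompositions -/

/-- `hv` is a heavy leaf path decomposition of `P`: for each internal node (position)
`p`, `hv p` is the index of a child with the maximum number of descendant leaves. -/
def IsHeavyDecomp (P : OTree α) (hv : Node → ℕ) : Prop :=
  ∀ p s, sub p P = some s → s.children ≠ [] →
    ∃ c, s.children[hv p]? = some c ∧ ∀ c' ∈ s.children, numLeaves c' ≤ numLeaves c

/-- `ldepth(v)`: the number of light edges on the path from the root to `v`. -/
def ldepth (hv : Node → ℕ) (v : Node) : ℕ :=
  (List.range v.length).countP (fun n => v.getD n 0 != hv (v.take n))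

/-- The light nodes on the path from the root to `v`, ordered by increasing depth
    (the root is light; a nonroot node is light iff it is not the heavy child
    of its parent). -/
def lightPrefixes (hv : Node → ℕ) (v : Node) : List Node :=
  ((List.range (v.length + 1)).map (fun n => v.take n)).filter
    (fun q => q.getLast? != some (hv q.dropLast))

/-- The position of `heavy(parent(q))` for a nonroot position `q`. -/
def heavySibPos (hv : Node → ℕ) (q : Node) : Node :=
  q.dropLast ++ [hv q.dropLast]

/-! ### Clusters -/

/-- Two positions are adjacent in the tree (parent/child). -/
def Adj (u v : Node) : Prop := (∃ i, v = u ++ [i]) ∨ (∃ i, u = v ++ [i])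

/-- `S` is (the vertex set of) a nonempty connected subgraph of `T`. -/
def Conn (T : OTree α) (S : Set Node) : Prop :=
  S.Nonempty ∧ S ⊆ Pos T ∧
    ∀ u ∈ S, ∀ v ∈ S, ∀ w, nca u v <+: w → (w <+: u ∨ w <+: v) → w ∈ S

/-- The boundary nodes of a connected subgraph `S` of `T`: nodes of `S` adjacent to a
node of `T` outside `S`, together with the root of `T` if it lies in `S`. -/
def Boundary (T : OTree α) (S : Set Node) : Set Node :=
  {v ∈ S | (∃ u ∈ Pos T, u ∉ S ∧ Adj v u) ∨ v = []}

/-- The edges of `T` joining two nodes of `S`. -/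
def EdgesIn (T : OTree α) (S : Set Node) : Set (Node × Node) :=
  {e | e.1 ∈ S ∧ e.2 ∈ S ∧ e.2 ∈ Pos T ∧ ∃ i, e.2 = e.1 ++ [i]}

/-- A cluster of `T`: a connected subgraph with at most two boundary nodes. -/
def IsCluster (T : OTree α) (S : Set Node) : Prop :=
  Conn T S ∧ (Boundary T S).encard ≤ 2

/-- A cluster partition of `T`. -/
structure IsClusterPartition (T : OTree α) (CS : List (Set Node)) : Prop where
  cluster : ∀ S ∈ CS, IsCluster T S
  coverV : ∀ p ∈ Pos T, ∃ S ∈ CS, p ∈ S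
  coverE : ∀ e ∈ EdgesIn T (Pos T), ∃ S ∈ CS, e ∈ EdgesIn T S
  disjE : CS.Pairwise (fun S₁ S₂ => EdgesIn T S₁ ∩ EdgesIn T S₂ = ∅)
  edge : ∀ S ∈ CS, (EdgesIn T S).Nonempty

/-- Binary tree: every node has at most two children. -/
def IsBinary (t : OTree α) : Prop := ∀ p s, sub p t = some s → s.children.length ≤ 2

/-- Relabeling of a tree. -/
def omap (f : α → β) : OTree α → OTree β
  | node a cs => node (f a) (cs.attach.map (fun c => omap f c.1))
termination_by t => sizeOf t
decreasing_by
  have := List.sizeOf_lt_of_mem c.2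
  simp only [OTree.node.sizeOf_spec]
  omega


/-! ### The left-to-right order and the lexicographic order -/

theorem nil_le (w : Node) : ([] : Node) ≤ w := by
  rcases w with _ | ⟨j, w⟩
  · exact le_rfl
  · exact le_of_lt (List.nil_lt_cons j w)

theorem cons_le_cons_iff {i j : ℕ} {u w : Node} :
    (i :: u : Node) ≤ j :: w ↔ i < j ∨ i = j ∧ u ≤ w := by
  rw [le_iff_lt_or_eq, le_iff_lt_or_eq, List.cons_lt_cons_iff, List.cons.injEq]
  tauto

theorem prefix_le {u w : Node} (h : u <+: w) : u ≤ w := by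
  induction u generalizing w with
  | nil => exact nil_le w
  | cons i u ih =>
    obtain ⟨t, rfl⟩ := h
    exact cons_le_cons_iff.2 (Or.inr ⟨rfl, ih (List.prefix_append u t)⟩)

theorem prefix_of_le_of_le {u x y z : Node} (hx : u <+: x) (hz : u <+: z)
    (hxy : x ≤ y) (hyz : y ≤ z) : u <+: y := by
  induction u generalizing x y z with
  | nil => exact List.nil_prefix
  | cons i u ih =>
    obtain ⟨x, rfl⟩ := hx
    obtain ⟨z, rfl⟩ := hz
    rcases y with _ | ⟨j, y⟩
    · exact absurd hxy (by simp)
    · rw [List.cons_append, cons_le_cons_iff] at hxy hyz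
      obtain ⟨rfl, hxy, hyz⟩ : i = j ∧ u ++ x ≤ y ∧ y ≤ u ++ z := by
        rcases hxy with h | ⟨h'', h⟩ <;> rcases hyz with h' | ⟨h''', h'⟩
        · omega
        · omega
        · omega
        · exact ⟨h'', h, h'⟩
      exact List.cons_prefix_cons.2
        ⟨rfl, ih (List.prefix_append u x) (List.prefix_append u z) hxy hyz⟩

theorem leftOf_cons_cons {i j : ℕ} {u w : Node} :
    LeftOf (i :: u) (j :: w) ↔ i < j ∨ i = j ∧ LeftOf u w := by
  constructor
  · rintro ⟨q, a, b, u', w', hab, h1, h2⟩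
    rcases q with _ | ⟨c, q⟩
    · simp only [List.nil_append, List.cons.injEq] at h1 h2
      omega
    · simp only [List.cons_append, List.cons.injEq] at h1 h2
      exact Or.inr ⟨h1.1.trans h2.1.symm, q, a, b, u', w', hab, h1.2, h2.2⟩
  · rintro (h | ⟨rfl, q, a, b, u', w', hab, rfl, rfl⟩)
    · exact ⟨[], i, j, u, w, h, rfl, rfl⟩
    · exact ⟨i :: q, a, b, u', w', hab, rfl, rfl⟩

theorem not_leftOf_nil_left (w : Node) : ¬ LeftOf [] w := by
  rintro ⟨q, a, b, u', w', -, h, -⟩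
  simp at h

theorem not_leftOf_nil_right (u : Node) : ¬ LeftOf u [] := by
  rintro ⟨q, a, b, u', w', -, -, h⟩
  simp at h

theorem leftOf_iff_lt_and_not_prefix {u w : Node} : LeftOf u w ↔ u < w ∧ ¬ u <+: w := by
  induction u generalizing w with
  | nil => simp [not_leftOf_nil_left]
  | cons i u ih =>
    rcases w with _ | ⟨j, w⟩
    · simp [not_leftOf_nil_right]
    · rw [leftOf_cons_cons, ih, List.cons_lt_cons_iff, List.cons_prefix_cons]
      constructor
      · rintro (h | ⟨rfl, h, h'⟩)
        · exact ⟨Or.inl h, fun h' => by omega⟩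
        · exact ⟨Or.inr ⟨rfl, h⟩, fun h'' => h' h''.2⟩
      · rintro ⟨h | ⟨rfl, h⟩, h'⟩
        · exact Or.inl h
        · exact Or.inr ⟨rfl, h, fun h'' => h' ⟨rfl, h''⟩⟩

theorem LeftOf.lt {u w : Node} (h : LeftOf u w) : u < w :=
  (leftOf_iff_lt_and_not_prefix.1 h).1

theorem LeftOf.not_prefix {u w : Node} (h : LeftOf u w) : ¬ u <+: w :=
  (leftOf_iff_lt_and_not_prefix.1 h).2

theorem LeftOf.not_prefix_symm {u w : Node} (h : LeftOf u w) : ¬ w <+: u :=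
  fun h' => (prefix_le h').not_gt h.lt

theorem LeftOf.trans {u v w : Node} (h : LeftOf u v) (h' : LeftOf v w) : LeftOf u w :=
  leftOf_iff_lt_and_not_prefix.2 ⟨h.lt.trans h'.lt, fun hp =>
    h.not_prefix (prefix_of_le_of_le (List.prefix_refl u) hp h.lt.le h'.lt.le)⟩

instance : Trans LeftOf LeftOf LeftOf := ⟨LeftOf.trans⟩

theorem LeftOf.mono {u w u' w' : Node} (h : LeftOf u w) (hu : u <+: u') (hw : w <+: w') :
    LeftOf u' w' := by
  obtain ⟨q, i, j, a, b, hij, rfl, rfl⟩ := h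
  obtain ⟨s, rfl⟩ := hu
  obtain ⟨t, rfl⟩ := hw
  exact ⟨q, i, j, a ++ s, b ++ t, hij, by simp, by simp⟩

/-- Within a deep set, `⊴` implies the weak lexicographic order. -/
theorem LeftOrAbove.le_of_deepSet {X : Set Node} (hX : DeepSet X) {u w : Node} (hu : u ∈ X)
    (hw : w ∈ X) (h : LeftOrAbove u w) : u ≤ w := by
  rcases h with h | h | h
  · exact h.lt.le
  · exact prefix_le h
  · exact absurd h (hX w hw u hu)

theorem nca_prefix_left (u w : Node) : nca u w <+: u := by
  induction u generalizing w with
  | nil => simp [nca]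
  | cons i u ih =>
    rcases w with _ | ⟨j, w⟩
    · simp [nca]
    · by_cases h : i = j
      · simpa [nca, h] using ih w
      · simp [nca, h]

theorem nca_prefix_right (u w : Node) : nca u w <+: w := by
  induction u generalizing w with
  | nil => simp [nca]
  | cons i u ih =>
    rcases w with _ | ⟨j, w⟩
    · simp [nca]
    · by_cases h : i = j
      · simpa [nca, h] using ih w
      · simp [nca, h]

theorem prefix_nca {q u w : Node} (hu : q <+: u) (hw : q <+: w) : q <+: nca u w := by
  induction q generalizing u w with
  | nil => exact List.nil_prefix
  | cons i q ih =>
    obtain ⟨u, rfl⟩ := hu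
    obtain ⟨w, rfl⟩ := hw
    simpa [nca] using ih (List.prefix_append q u) (List.prefix_append q w)

/-! ### Positions and embeddings -/

theorem nil_mem_pos (t : OTree α) : [] ∈ Pos t := by simp [Pos, sub]

theorem cons_mem_pos {a : α} {cs : List (OTree α)} {i : ℕ} {p : Node} :
    i :: p ∈ Pos (node a cs) ↔ ∃ hi : i < cs.length, p ∈ Pos cs[i] := by
  by_cases hi : i < cs.length
  · simp [Pos, sub, children, hi]
  · simp [Pos, sub, children, hi]

theorem labelAt_cons {a : α} {cs : List (OTree α)} {i : ℕ} (hi : i < cs.length) (p : Node) :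
    labelAt (node a cs) (i :: p) = labelAt cs[i] p := by
  simp [labelAt, sub, children, hi]

theorem pos_finite : ∀ t : OTree α, (Pos t).Finite
  | node a cs => by
    have hfin : ∀ i : Fin cs.length, (Pos cs[i]).Finite := fun i => pos_finite cs[i]
    refine ((Set.finite_singleton ([] : Node)).union
      (Set.finite_iUnion fun i : Fin cs.length => (hfin i).image (List.cons i.1))).subset ?_
    rintro (_ | ⟨i, p⟩) hp
    · exact Or.inl rfl
    · obtain ⟨hi, hp⟩ := cons_mem_pos.1 hp
      exact Or.inr (Set.mem_iUnion.2 ⟨⟨i, hi⟩, p, hp, rfl⟩)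
termination_by t => sizeOf t
decreasing_by
  have := List.sizeOf_lt_of_mem (List.getElem_mem i.2)
  simp only [OTree.node.sizeOf_spec, Fin.getElem_fin]
  omega

theorem IsEmb.root_prefix {P T : OTree α} {f : Node → Node} (hf : IsEmb P T f) {p : Node}
    (hp : p ∈ Pos P) : f [] <+: f p := by
  rcases p with _ | ⟨i, p⟩
  · exact List.prefix_refl _
  · exact ((hf.anc [] (nil_mem_pos P) _ hp).1 ⟨List.nil_prefix, by simp⟩).1

theorem deepSet_emb (P T : OTree α) : DeepSet (emb P T) := by
  rintro _ ⟨f, hf, rfl⟩ _ ⟨g, hg, rfl⟩ h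
  exact hf.2 ⟨g, hg.1, h⟩

theorem emb_subset_pos (P T : OTree α) : emb P T ⊆ Pos T := by
  rintro _ ⟨f, hf, rfl⟩
  exact hf.1.mem [] (nil_mem_pos P)

theorem IsEmb.exists_mem_emb {P T : OTree α} {f : Node → Node} (hf : IsEmb P T f) :
    ∃ x ∈ emb P T, f [] <+: x := by
  let S : Set Node := {x | (∃ g, IsEmb P T g ∧ g [] = x) ∧ f [] <+: x}
  have hfin : S.Finite := (pos_finite T).subset <| by
    rintro _ ⟨⟨g, hg, rfl⟩, -⟩
    exact hg.mem [] (nil_mem_pos P)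
  obtain ⟨x, ⟨⟨g, hg, rfl⟩, hx⟩, hmax⟩ :=
    hfin.exists_maximalFor List.length S ⟨f [], ⟨f, hf, rfl⟩, List.prefix_refl _⟩
  refine ⟨g [], ⟨g, ⟨hg, ?_⟩, rfl⟩, hx⟩
  rintro ⟨h, hh, hlt, hne⟩
  exact hne (hlt.eq_of_length_le
    (hmax (j := h []) ⟨⟨h, hh, rfl⟩, hx.trans hlt⟩ hlt.length_le))

theorem IsEmb.child {a : α} {cs : List (OTree α)} {T : OTree α} {f : Node → Node}
    (hf : IsEmb (node a cs) T f) {i : ℕ} (hi : i < cs.length) :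
    IsEmb cs[i] T (fun p => f (i :: p)) where
  mem p hp := hf.mem _ (cons_mem_pos.2 ⟨hi, hp⟩)
  inj p hp q hq h := by
    simpa using hf.inj _ (cons_mem_pos.2 ⟨hi, hp⟩) _ (cons_mem_pos.2 ⟨hi, hq⟩) h
  lab p hp := (hf.lab _ (cons_mem_pos.2 ⟨hi, hp⟩)).trans (labelAt_cons hi p)
  anc p hp q hq := by
    rw [← hf.anc _ (cons_mem_pos.2 ⟨hi, hp⟩) _ (cons_mem_pos.2 ⟨hi, hq⟩)]
    simp [SAnc]
  ord p hp q hq := by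
    rw [← hf.ord _ (cons_mem_pos.2 ⟨hi, hp⟩) _ (cons_mem_pos.2 ⟨hi, hq⟩)]
    simp [leftOf_cons_cons]

/-- Glue maps of the children of a node into a map of the node sending the root to `r`. -/
def glue (r : Node) (g : ℕ → Node → Node) : Node → Node
  | [] => r
  | i :: p => g i p

theorem isEmb_glue {a : α} {cs : List (OTree α)} {T : OTree α} {r : Node}
    {g : ℕ → Node → Node} (hr : r ∈ Pos T) (hlab : labelAt T r = some a)
    (hg : ∀ i (hi : i < cs.length), IsEmb cs[i] T (g i))
    (hrg : ∀ i < cs.length, SAnc r (g i []))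
    (hord : ∀ i j, i < j → j < cs.length → LeftOf (g i []) (g j [])) :
    IsEmb (node a cs) T (glue r g) := by
  have hbelow : ∀ i (hi : i < cs.length), ∀ p ∈ Pos cs[i], SAnc r (g i p) := by
    intro i hi p hp
    have h := (hg i hi).root_prefix hp
    refine ⟨(hrg i hi).1.trans h, fun he => (hrg i hi).2 ?_⟩
    exact (hrg i hi).1.eq_of_length_le (he ▸ h.length_le)
  have hleft : ∀ i (hi : i < cs.length) j (hj : j < cs.length), i < j →
      ∀ p ∈ Pos cs[i], ∀ q ∈ Pos cs[j], LeftOf (g i p) (g j q) := fun i hi j hj hij p hp q hq =>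
    (hord i j hij hj).mono ((hg i hi).root_prefix hp) ((hg j hj).root_prefix hq)
  have hnot : ∀ {x : Node}, SAnc r x → ¬ x <+: r := fun h h' =>
    h.2 (h.1.eq_of_length_le h'.length_le)
  constructor
  · rintro (_ | ⟨i, p⟩) hp
    · exact hr
    · obtain ⟨hi, hp⟩ := cons_mem_pos.1 hp
      exact (hg i hi).mem p hp
  · rintro (_ | ⟨i, p⟩) hp (_ | ⟨j, q⟩) hq h
    · rfl
    · obtain ⟨hj, hq⟩ := cons_mem_pos.1 hq
      exact absurd h (hbelow j hj q hq).2
    · obtain ⟨hi, hp⟩ := cons_mem_pos.1 hp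
      exact absurd h.symm (hbelow i hi p hp).2
    · obtain ⟨hi, hp⟩ := cons_mem_pos.1 hp
      obtain ⟨hj, hq⟩ := cons_mem_pos.1 hq
      change g i p = g j q at h
      rcases lt_trichotomy i j with hij | rfl | hij
      · exact absurd h (hleft i hi j hj hij p hp q hq).lt.ne
      · rw [(hg i hi).inj p hp q hq h]
      · exact absurd h (hleft j hj i hi hij q hq p hp).lt.ne'
  · rintro (_ | ⟨i, p⟩) hp
    · exact hlab
    · obtain ⟨hi, hp⟩ := cons_mem_pos.1 hp
      exact ((hg i hi).lab p hp).trans (labelAt_cons hi p).symm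
  · rintro (_ | ⟨i, p⟩) hp (_ | ⟨j, q⟩) hq
    · simp [SAnc]
    · obtain ⟨hj, hq⟩ := cons_mem_pos.1 hq
      exact iff_of_true ⟨List.nil_prefix, by simp⟩ (hbelow j hj q hq)
    · obtain ⟨hi, hp⟩ := cons_mem_pos.1 hp
      exact iff_of_false (fun h => by simpa using h.1)
        (fun h => hnot (hbelow i hi p hp) h.1)
    · obtain ⟨hi, hp⟩ := cons_mem_pos.1 hp
      obtain ⟨hj, hq⟩ := cons_mem_pos.1 hq
      change _ ↔ SAnc (g i p) (g j q)
      rcases lt_trichotomy i j with hij | rfl | hij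
      · exact iff_of_false (fun h => hij.ne (List.cons_prefix_cons.1 h.1).1)
          (fun h => (hleft i hi j hj hij p hp q hq).not_prefix h.1)
      · rw [← (hg i hi).anc p hp q hq]
        simp [SAnc]
      · exact iff_of_false (fun h => hij.ne' (List.cons_prefix_cons.1 h.1).1)
          (fun h => (hleft j hj i hi hij q hq p hp).not_prefix_symm h.1)
  · rintro (_ | ⟨i, p⟩) hp (_ | ⟨j, q⟩) hq
    · exact iff_of_false (not_leftOf_nil_left _) (fun h => h.lt.ne rfl)
    · obtain ⟨hj, hq⟩ := cons_mem_pos.1 hq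
      exact iff_of_false (not_leftOf_nil_left _)
        (fun h => h.not_prefix (hbelow j hj q hq).1)
    · obtain ⟨hi, hp⟩ := cons_mem_pos.1 hp
      exact iff_of_false (not_leftOf_nil_right _)
        (fun h => h.not_prefix_symm (hbelow i hi p hp).1)
    · obtain ⟨hi, hp⟩ := cons_mem_pos.1 hp
      obtain ⟨hj, hq⟩ := cons_mem_pos.1 hq
      change _ ↔ LeftOf (g i p) (g j q)
      rw [leftOf_cons_cons]
      rcases lt_trichotomy i j with hij | rfl | hij
      · exact iff_of_true (Or.inl hij) (hleft i hi j hj hij p hp q hq)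
      · rw [← (hg i hi).ord p hp q hq]
        simp
      · exact iff_of_false (by omega)
          (fun h => (hleft j hj i hi hij q hq p hp).lt.not_gt h.lt)

/-! ### Minimum ordered pairs of deep occurrences -/

theorem phi_emb_iff {cs : List (OTree α)} {T : OTree α} {xs : List Node} :
    Phi (cs.map fun c => emb c T) xs ↔
      xs.length = cs.length ∧
      (∀ i (hi : i < xs.length) (hi' : i < cs.length), xs[i] ∈ emb cs[i] T) ∧
      ∀ i j (hi : i < xs.length) (hj : j < xs.length), i < j → LeftOf xs[i] xs[j] := by
  have hchain : xs.IsChain LeftOf ↔ _ :=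
    List.isChain_iff_pairwise.trans List.pairwise_iff_getElem
  refine (and_congr List.forall₂_iff_get hchain).trans ?_
  simp [and_assoc]

/-- The first and last entries of a tuple of `Φ` for deep occurrences. -/
theorem Phi.endpoints {cs : List (OTree α)} {T : OTree α} {xs : List Node} {x y : Node}
    (h : Phi (cs.map fun c => emb c T) xs) (hx : xs.head? = some x)
    (hy : xs.getLast? = some y) :
    ∃ hc : 0 < cs.length, x ∈ emb cs[0] T ∧ y ∈ emb cs[cs.length - 1] T ∧
      ∀ i (hi : i < xs.length), x ≤ xs[i] ∧ xs[i] ≤ y := by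
  obtain ⟨hlen, hmem, hord⟩ := phi_emb_iff.1 h
  rw [List.head?_eq_getElem?] at hx
  rw [List.getLast?_eq_getElem?] at hy
  obtain ⟨h0, rfl⟩ := List.getElem?_eq_some_iff.1 hx
  obtain ⟨h1, rfl⟩ := List.getElem?_eq_some_iff.1 hy
  refine ⟨by omega, hmem 0 _ _, ?_, fun i hi => ⟨?_, ?_⟩⟩
  · simpa only [hlen] using hmem (xs.length - 1) h1 (by omega)
  · rcases Nat.eq_zero_or_pos i with rfl | hpos
    · exact le_rfl
    · exact (hord 0 i h0 hi hpos).lt.le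
  · rcases (Nat.le_sub_one_of_lt hi).eq_or_lt with rfl | hlt
    · exact le_rfl
    · exact (hord i _ hi h1 hlt).lt.le

/-- Every tuple of `Φ` of deep occurrences spans an interval containing a minimum ordered pair. -/
theorem Phi.exists_mem_mop {cs : List (OTree α)} {T : OTree α} {xs : List Node} {x y : Node}
    (h : Phi (cs.map fun c => emb c T) xs) (hx : xs.head? = some x)
    (hy : xs.getLast? = some y) :
    ∃ w1 wk, (w1, wk) ∈ Mop (cs.map fun c => emb c T) ∧ x ≤ w1 ∧ wk ≤ y := by
  let S : Set (Nodeᵒᵈ × Node) := {p | ∃ ys, Phi (cs.map fun c => emb c T) ys ∧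
    ys.head? = some (OrderDual.ofDual p.1) ∧ ys.getLast? = some p.2}
  have hfin : S.Finite := by
    refine (((pos_finite T).preimage
      OrderDual.ofDual.injective.injOn).prod (pos_finite T)).subset ?_
    rintro p ⟨ys, hys, h1, hk⟩
    obtain ⟨_, hm1, hmk, -⟩ := hys.endpoints h1 hk
    exact ⟨emb_subset_pos _ _ hm1, emb_subset_pos _ _ hmk⟩
  obtain ⟨⟨w1, wk⟩, hle, ⟨ys, hys, h1, hk⟩, hmin⟩ :=
    hfin.exists_le_minimal (a := (OrderDual.toDual x, y)) ⟨xs, h, hx, hy⟩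
  refine ⟨OrderDual.ofDual w1, wk, ⟨⟨ys, hys, h1, hk⟩, ?_⟩, hle.1, hle.2⟩
  rintro ⟨zs, z1, zk, hzs, hz1, hzk, hbetter⟩
  obtain ⟨_, hm1, hmk, -⟩ := hys.endpoints h1 hk
  obtain ⟨_, hn1, hnk, -⟩ := hzs.endpoints hz1 hzk
  rcases hbetter with ⟨hlt, -, hle'⟩ | ⟨hle', -, hlt⟩
  · have hle'' := hle'.le_of_deepSet (deepSet_emb _ _) hnk hmk
    have := @hmin (OrderDual.toDual z1, zk) ⟨zs, hzs, hz1, hzk⟩ ⟨hlt.lt.le, hle''⟩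
    exact hlt.lt.not_ge this.1
  · have hle'' := hle'.le_of_deepSet (deepSet_emb _ _) hm1 hn1
    have := @hmin (OrderDual.toDual z1, zk) ⟨zs, hzs, hz1, hzk⟩ ⟨hle'', hlt.lt.le⟩
    exact hlt.lt.not_ge this.2

/-- A tuple of `Φ` of deep occurrences of the children, strictly below a node labeled like the
parent, extends to an embedding of the parent. -/
theorem Phi.exists_isEmb {a : α} {cs : List (OTree α)} {T : OTree α} {xs : List Node} {r : Node}
    (h : Phi (cs.map fun c => emb c T) xs) (hlab : labelAt T r = some a)
    (hr : ∀ i (hi : i < xs.length), SAnc r xs[i]) :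
    ∃ g, IsEmb (node a cs) T g ∧ g [] = r := by
  obtain ⟨hlen, hmem, hord⟩ := phi_emb_iff.1 h
  have hex : ∀ i, ∃ g : Node → Node, ∀ (hi : i < xs.length) (hi' : i < cs.length),
      IsEmb cs[i] T g ∧ g [] = xs[i] := by
    intro i
    by_cases hi : i < xs.length
    · obtain ⟨g, hg, hgi⟩ := hmem i hi (by omega)
      exact ⟨g, fun _ _ => ⟨hg.1, hgi⟩⟩
    · exact ⟨id, fun hi' => absurd hi' hi⟩
  choose g hg using hex
  refine ⟨glue r g, isEmb_glue ?_ hlab (fun i hi => (hg i (by omega) hi).1) ?_ ?_, rfl⟩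
  · intro hnone
    simp [labelAt, hnone] at hlab
  · intro i hi
    rw [(hg i (by omega) hi).2]
    exact hr i (by omega)
  · intro i j hij hj
    rw [(hg i (by omega) (by omega)).2, (hg j (by omega) hj).2]
    exact hord i j _ _ hij

/-- (Proposition 1) Every deep occurrence `w` of `P(v)` (where `v`
has children `v_1, …, v_k`, `k ≥ 2`) is of the form `fl(nca(w_1, w_k), label(v))` for
some `(w_1, w_k) ∈ mop(emb(P(v_1),T), …, emb(P(v_k),T))`. -/
theorem emb_eq_fl_nca_mop {α : Type} (P T : OTree α) (v : Node)
    (a : α) (cs : List (OTree α)) (hs : sub v P = some (OTree.node a cs))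
    (hk : 2 ≤ cs.length) (w : Node) (hw : w ∈ emb (OTree.node a cs) T) :
    ∃ w1 wk : Node, (w1, wk) ∈ Mop (cs.map (fun c => emb c T)) ∧
      FlAt T (nca w1 wk) a w := by
  obtain ⟨f, ⟨hf, hdeep⟩, rfl⟩ := hw
  have hex : ∀ i : Fin cs.length, ∃ x ∈ emb cs[i] T, f [i.1] <+: x :=
    fun i => (hf.child i.2).exists_mem_emb
  choose x hx hfx using hex
  have hpos : ∀ i : Fin cs.length, [i.1] ∈ Pos (node a cs) :=
    fun i => cons_mem_pos.2 ⟨i.2, nil_mem_pos _⟩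
  have hroot : ∀ i, f [] <+: x i := fun i => (hf.root_prefix (hpos i)).trans (hfx i)
  have hphi : Phi (cs.map fun c => emb c T) (List.ofFn x) := by
    refine phi_emb_iff.2 ⟨by simp, fun i hi hi' => by simpa using hx ⟨i, hi'⟩,
      fun i j hi hj hij => ?_⟩
    simp only [List.length_ofFn] at hi hj
    have hlt : LeftOf (f [i]) (f [j]) := (hf.ord _ (hpos ⟨i, hi⟩) _ (hpos ⟨j, hj⟩)).1
      (leftOf_cons_cons.2 (Or.inl hij))
    simpa using hlt.mono (hfx ⟨i, hi⟩) (hfx ⟨j, hj⟩)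
  have hhead : (List.ofFn x).head? = some (x ⟨0, by omega⟩) := by
    rw [List.head?_eq_getElem?, List.getElem?_eq_some_iff]
    exact ⟨by simp; omega, by simp⟩
  have hlast : (List.ofFn x).getLast? = some (x ⟨cs.length - 1, by omega⟩) := by
    rw [List.getLast?_eq_getElem?, List.getElem?_eq_some_iff]
    exact ⟨by simp; omega, by simp⟩
  obtain ⟨w1, wk, hmop, h1, hk'⟩ := hphi.exists_mem_mop hhead hlast
  refine ⟨w1, wk, hmop, ?_⟩
  obtain ⟨⟨ys, hys, hy1, hyk⟩, -⟩ := hmop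
  obtain ⟨hlen, -, hord⟩ := phi_emb_iff.1 hys
  obtain ⟨_, -, -, hbetween⟩ := hys.endpoints hy1 hyk
  have hlt : LeftOf w1 wk := by
    rw [List.head?_eq_getElem?] at hy1
    rw [List.getLast?_eq_getElem?] at hyk
    obtain ⟨h0, rfl⟩ := List.getElem?_eq_some_iff.1 hy1
    obtain ⟨hl, rfl⟩ := List.getElem?_eq_some_iff.1 hyk
    exact hord _ _ h0 hl (by omega)
  have hlab : labelAt T (f []) = some a := hf.lab [] (nil_mem_pos _)
  refine ⟨prefix_nca
    (prefix_of_le_of_le (hroot _) (hroot _) h1 (hlt.lt.le.trans hk'))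
    (prefix_of_le_of_le (hroot _) (hroot _) (h1.trans hlt.lt.le) hk'), hlab, ?_⟩
  intro r hr hrnca hrlab
  have hr1 : r <+: w1 := hrnca.trans (nca_prefix_left w1 wk)
  have hrk : r <+: wk := hrnca.trans (nca_prefix_right w1 wk)
  have hbelow : ∀ i (hi : i < ys.length), SAnc r ys[i] := by
    intro i hi
    obtain ⟨hle1, hlek⟩ := hbetween i hi
    refine ⟨prefix_of_le_of_le hr1 hrk hle1 hlek, ?_⟩
    rintro heq
    have hw1 : ys[i] = w1 := le_antisymm (heq ▸ prefix_le hr1) hle1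
    exact hlt.not_prefix (hw1 ▸ heq ▸ hrk)
  obtain ⟨g, hg, hgr⟩ := hys.exists_isEmb hrlab hbelow
  exact hdeep ⟨g, hg, hgr ▸ hr⟩

end OTree

end TreeIncl
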